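/- For every λ = (λ_1,…,λ_c) ∈ k^c, the element u_λ = λ_1 x_1 + ⋯ + λ_c x_c of A satisfies u_λ^a = 0. -/

import Mathlib

open scoped TensorProduct

/-- The relations defining the quantum complete intersection `A^c_q`:
`x_i ^ a = 0` for all `i`, and `x_i x_j = q • x_j x_i` for `i < j`. -/
inductive QCIRel (k : Type) [Field k] (c a : ℕ) (q : k) :
    FreeAlgebra k (Fin c) → FreeAlgebra k (Fin c) → Prop
  | pow (i : Fin c) : QCIRel k c a q (FreeAlgebra.ι k i ^ a) 0
  | comm (i j : Fin c) (hij : i < j) :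
      QCIRel k c a q (FreeAlgebra.ι k i * FreeAlgebra.ι k j)
        (q • (FreeAlgebra.ι k j * FreeAlgebra.ι k i))

/-- The quantum complete intersection algebra `A^c_q = k⟨x_1,…,x_c⟩/(x_i^a, x_ix_j - q x_jx_i)`. -/
def QCI (k : Type) [Field k] (c a : ℕ) (q : k) : Type := RingQuot (QCIRel k c a q)

noncomputable instance (k : Type) [Field k] (c a : ℕ) (q : k) : Ring (QCI k c a q) :=
  inferInstanceAs (Ring (RingQuot (QCIRel k c a q)))

noncomputable instance (k : Type) [Field k] (c a : ℕ) (q : k) : Algebra k (QCI k c a q) :=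
  inferInstanceAs (Algebra k (RingQuot (QCIRel k c a q)))

namespace QCI

variable (k : Type) [Field k] (c a : ℕ) (q : k)

/-- The generators `x_i` of the quantum complete intersection. -/
noncomputable def x (i : Fin c) : QCI k c a q :=
  RingQuot.mkAlgHom k (QCIRel k c a q) (FreeAlgebra.ι k i)

/-- The element `u_λ = λ_1 x_1 + ⋯ + λ_c x_c` of `A^c_q`. -/
noncomputable def u (lam : Fin c → k) : QCI k c a q :=
  ∑ i, lam i • QCI.x k c a q i

end QCI

/-- `a' = a / gcd(a, char k)` if `char k > 0`, and `a' = a` if `char k = 0`. -/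
noncomputable def aprime (k : Type) [Field k] (a : ℕ) : ℕ :=
  if ringChar k > 0 then a / Nat.gcd a (ringChar k) else a

/-- The Gaussian binomial coefficients evaluated at `q`, defined by the `q`-Pascal recursion. -/
def qChoose {R : Type*} [Semiring R] (q : R) : ℕ → ℕ → R
  | _, 0 => 1
  | 0, _ + 1 => 0
  | n + 1, i + 1 => qChoose q n i + q ^ (i + 1) * qChoose q n (i + 1)

section QChoose

variable {R : Type*}

lemma qChoose_zero_right [Semiring R] (q : R) (n : ℕ) : qChoose q n 0 = 1 := by
  cases n <;> rfl

lemma qChoose_succ_succ [Semiring R] (q : R) (n i : ℕ) :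
    qChoose q (n + 1) (i + 1) = qChoose q n i + q ^ (i + 1) * qChoose q n (i + 1) := rfl

lemma qChoose_eq_zero_of_lt [Semiring R] (q : R) {n i : ℕ} (h : n < i) : qChoose q n i = 0 := by
  induction n generalizing i with
  | zero => obtain ⟨i, rfl⟩ := Nat.exists_eq_succ_of_ne_zero h.ne'; rfl
  | succ n ih =>
    obtain ⟨i, rfl⟩ := Nat.exists_eq_succ_of_ne_zero (Nat.ne_zero_of_lt h)
    rw [Nat.succ_eq_add_one, qChoose_succ_succ, ih (by omega), ih (by omega), mul_zero, add_zero]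

lemma qChoose_self [Semiring R] (q : R) (n : ℕ) : qChoose q n n = 1 := by
  induction n with
  | zero => rfl
  | succ n ih =>
    rw [qChoose_succ_succ, ih, qChoose_eq_zero_of_lt q n.lt_succ_self, mul_zero, add_zero]

lemma qChoose_succ_right_mul [CommRing R] (q : R) (n i : ℕ) :
    q ^ i * (q ^ (i + 1) - 1) * qChoose q n (i + 1) = (q ^ n - q ^ i) * qChoose q n i := by
  induction n generalizing i with
  | zero =>
    rw [qChoose_eq_zero_of_lt q i.succ_pos]
    cases i with
    | zero => simp
    | succ i => simp [qChoose_eq_zero_of_lt q i.succ_pos]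
  | succ n ih =>
    cases i with
    | zero =>
      have h := ih 0
      rw [qChoose_succ_succ]
      simp only [qChoose_zero_right] at h ⊢
      linear_combination q * h
    | succ i =>
      have h₀ := ih i
      have h₁ := ih (i + 1)
      rw [qChoose_succ_succ, qChoose_succ_succ q n i]
      linear_combination q ^ (i + 2) * h₁ + q * h₀

lemma IsPrimitiveRoot.qChoose_eq_zero [CommRing R] [IsDomain R] {q : R} {n i : ℕ}
    (hq : IsPrimitiveRoot q n) (h₀ : i ≠ 0) (hn : i < n) : qChoose q n i = 0 := by
  obtain ⟨i, rfl⟩ := Nat.exists_eq_succ_of_ne_zero h₀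
  have key : q ^ i * (q ^ (i + 1) - 1) * qChoose q n (i + 1) = 0 := by
    rw [qChoose_succ_right_mul, hq.pow_eq_one]
    rcases eq_or_ne i 0 with rfl | hi
    · simp
    · rw [hq.qChoose_eq_zero hi (by omega), mul_zero]
  have hq₀ : q ≠ 0 := hq.ne_zero (by omega)
  have hq₁ : q ^ (i + 1) - 1 ≠ 0 := sub_ne_zero.2 (hq.pow_ne_one_of_pos_of_lt h₀ hn)
  simpa [hq₀, hq₁] using key

end QChoose

section QCommute

variable {R A : Type*} [CommRing R] [Ring A] [Algebra R A] {q : R} {x y : A}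

lemma mul_pow_of_mul_eq_smul (h : x * y = q • (y * x)) (n : ℕ) :
    x * y ^ n = q ^ n • (y ^ n * x) := by
  induction n with
  | zero => simp
  | succ n ih =>
    rw [pow_succ y, ← mul_assoc, ih, smul_mul_assoc, mul_assoc, h, mul_smul_comm, smul_smul,
      ← mul_assoc, ← pow_succ]

lemma pow_mul_of_mul_eq_smul (h : x * y = q • (y * x)) (n : ℕ) :
    x ^ n * y = q ^ n • (y * x ^ n) := by
  induction n with
  | zero => simp
  | succ n ih =>
    rw [pow_succ' x, mul_assoc, ih, mul_smul_comm, ← mul_assoc, h, smul_mul_assoc, smul_smul,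
      mul_assoc, ← pow_succ]

/-- The `q`-binomial theorem. -/
lemma add_pow_of_mul_eq_smul (h : x * y = q • (y * x)) (n : ℕ) :
    (x + y) ^ n =
      ∑ p ∈ Finset.HasAntidiagonal.antidiagonal n, qChoose q n p.1 • (y ^ p.1 * x ^ p.2) := by
  induction n with
  | zero => simp [qChoose_zero_right]
  | succ n ih =>
    have hx : x * ∑ p ∈ Finset.HasAntidiagonal.antidiagonal n, qChoose q n p.1 • (y ^ p.1 * x ^ p.2) =
        ∑ p ∈ Finset.HasAntidiagonal.antidiagonal (n + 1),
          (q ^ p.1 * qChoose q n p.1) • (y ^ p.1 * x ^ p.2) := by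
      rw [Finset.Nat.sum_antidiagonal_succ', qChoose_eq_zero_of_lt q n.lt_succ_self, mul_zero,
        zero_smul, zero_add, Finset.mul_sum]
      refine Finset.sum_congr rfl fun p _ => ?_
      rw [mul_smul_comm, ← mul_assoc, mul_pow_of_mul_eq_smul h, smul_mul_assoc, smul_smul,
        mul_assoc, ← pow_succ', mul_comm]
    rw [pow_succ', ih, add_mul, hx, Finset.Nat.sum_antidiagonal_succ,
      Finset.Nat.sum_antidiagonal_succ, Finset.mul_sum, add_assoc, ← Finset.sum_add_distrib]
    congr 1
    · simp [qChoose_zero_right]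
    · refine Finset.sum_congr rfl fun p _ => ?_
      rw [mul_smul_comm, ← mul_assoc, ← pow_succ', ← add_smul, qChoose_succ_succ, add_comm]

lemma IsPrimitiveRoot.add_pow_of_mul_eq_smul [IsDomain R] {n : ℕ} (hq : IsPrimitiveRoot q n)
    (hn : n ≠ 0) (h : x * y = q • (y * x)) : (x + y) ^ n = x ^ n + y ^ n := by
  obtain ⟨n, rfl⟩ := Nat.exists_eq_succ_of_ne_zero hn
  rw [_root_.add_pow_of_mul_eq_smul h, Nat.succ_eq_add_one, Finset.Nat.sum_antidiagonal_succ]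
  congr 1
  · simp [qChoose_zero_right]
  · rw [Finset.sum_eq_single (n, 0)]
    · simp [qChoose_self]
    · rintro ⟨i, j⟩ hp hne
      rw [Finset.HasAntidiagonal.mem_antidiagonal] at hp
      have hi : i ≠ n := by
        rintro rfl
        exact hne (by simpa using hp)
      rw [hq.qChoose_eq_zero (Nat.succ_ne_zero i) (by dsimp only at hp ⊢; omega), zero_smul]
    · simp

lemma add_pow_mul_of_mul_eq_smul [IsDomain R] {n d : ℕ} (hq : IsPrimitiveRoot q n) (hn : n ≠ 0)
    (hd : d = 1 ∨ d.Prime ∧ CharP R d) (h : x * y = q • (y * x)) :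
    (x + y) ^ (n * d) = x ^ (n * d) + y ^ (n * d) := by
  rw [pow_mul, hq.add_pow_of_mul_eq_smul hn h, pow_mul, pow_mul]
  rcases hd with rfl | ⟨hp, hR⟩
  · simp only [pow_one]
  · rcases subsingleton_or_nontrivial A with _ | _
    · exact Subsingleton.elim _ _
    have : Fact d.Prime := ⟨hp⟩
    have : ExpChar A d := by
      have : ExpChar R d := .prime hp
      have : CharP A d := by
        refine (CharP.charP_iff_prime_eq_zero hp).2 ?_
        rw [← map_natCast (algebraMap R A), CharP.cast_eq_zero, map_zero]
      exact .prime hp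
    have hcomm : Commute (x ^ n) (y ^ n) := by
      have hy := mul_pow_of_mul_eq_smul (pow_mul_of_mul_eq_smul h n) n
      rwa [hq.pow_eq_one, one_pow, one_smul] at hy
    exact add_pow_expChar_of_commute d hcomm

lemma sum_pow_of_mul_eq_smul {ι : Type*} [LinearOrder ι] [IsDomain R] {n d : ℕ}
    (hq : IsPrimitiveRoot q n) (hn : n ≠ 0) (hd : d = 1 ∨ d.Prime ∧ CharP R d) {f : ι → A}
    (h : ∀ i j, i < j → f i * f j = q • (f j * f i)) (s : Finset ι) :
    (∑ i ∈ s, f i) ^ (n * d) = ∑ i ∈ s, f i ^ (n * d) := by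
  induction s using Finset.induction_on_max with
  | empty =>
    have : d ≠ 0 := by rcases hd with rfl | ⟨hp, -⟩; exacts [one_ne_zero, hp.ne_zero]
    simp [hn, this]
  | insert j s hj ih =>
    have hjs : j ∉ s := fun hs => (hj j hs).false
    rw [Finset.sum_insert hjs, Finset.sum_insert hjs, add_comm,
      add_pow_mul_of_mul_eq_smul hq hn hd, ih, add_comm]
    rw [Finset.sum_mul, Finset.mul_sum, Finset.smul_sum]
    exact Finset.sum_congr rfl fun i hi => h i j (hj i hi)

end QCommute

namespace QCI

variable {k : Type} [Field k] {c a : ℕ} {q : k}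

lemma x_pow (i : Fin c) : x k c a q i ^ a = 0 := by
  have h := RingQuot.mkAlgHom_rel k (QCIRel.pow (k := k) (a := a) (q := q) i)
  rw [map_pow, map_zero] at h
  exact h

lemma x_mul_x {i j : Fin c} (hij : i < j) :
    x k c a q i * x k c a q j = q • (x k c a q j * x k c a q i) := by
  have h := RingQuot.mkAlgHom_rel k (QCIRel.comm (k := k) (a := a) (q := q) i j hij)
  rw [map_smul, map_mul, map_mul] at h
  exact h

end QCI

lemma exists_aprime_mul_eq (k : Type) [Field k] (a : ℕ) :
    ∃ d, aprime k a * d = a ∧ (d = 1 ∨ d.Prime ∧ CharP k d) := by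
  unfold aprime
  split_ifs with h
  · refine ⟨_, Nat.div_mul_cancel (Nat.gcd_dvd_left _ _), ?_⟩
    have hp : (ringChar k).Prime := (CharP.char_is_prime_or_zero k _).resolve_right h.ne'
    rcases hp.eq_one_or_self_of_dvd _ (Nat.gcd_dvd_right a _) with h | h
    · exact .inl h
    · rw [h]
      exact .inr ⟨hp, ringChar.charP k⟩
  · exact ⟨1, mul_one a, .inl rfl⟩

/-- For every `λ = (λ_1,…,λ_c) ∈ k^c`, the element `u_λ = λ_1 x_1 + ⋯ + λ_c x_c` of the
quantum complete intersection `A = A^c_q` satisfies `u_λ^a = 0`. -/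
theorem uLam_pow_eq_zero (k : Type) [Field k] [IsAlgClosed k] (a c : ℕ) (ha : 2 ≤ a)
    (hc : 1 ≤ c) (q : k) (hq : IsPrimitiveRoot q (aprime k a)) (lam : Fin c → k) :
    QCI.u k c a q lam ^ a = 0 := by
  obtain ⟨d, hda, hd⟩ := exists_aprime_mul_eq k a
  have hn : aprime k a ≠ 0 := by
    intro h
    rw [h, zero_mul] at hda
    omega
  have hsum := sum_pow_of_mul_eq_smul hq hn hd (f := fun i => lam i • QCI.x k c a q i)
    (fun i j hij => by
      simp only [smul_mul_smul_comm, QCI.x_mul_x hij]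
      rw [smul_comm, mul_comm]) Finset.univ
  rw [hda] at hsum
  rw [QCI.u, hsum]
  exact Finset.sum_eq_zero fun i _ => by rw [smul_pow, QCI.x_pow, smul_zero]
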